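/- Let L be an ample line bundle of type δ = (d₁,...,d_g) on an abelian variety A and G(L) its theta group. For each n ≥ 1, the set of isomorphism classes of irreducible representations of G(L) of weight n (i.e. on which α ∈ ℂ* ⊂ G(L) acts as multiplication by α^n) is in bijection with the set of characters of the subgroup K(L)_n of n-torsion elements of K(L); moreover every such irreducible representation has dimension (d₁d₂⋯d_g)/((n,d₁)(n,d₂)⋯(n,d_g)), where (n,d_k) denotes gcd(n,d_k). -/

import Mathlib

/-!
STATEMENT 14.
Let `L` be an ample line bundle of type `δ = (d₁,…,d_g)` on an abelian variety
`A` and `𝒢(L)` its theta group.  For each `n ≥ 1`, the set of isomorphism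
classes of irreducible representations of `𝒢(L)` of weight `n` (i.e. on which
`α ∈ ℂ* ⊆ 𝒢(L)` acts as multiplication by `αⁿ`) is in bijection with the set
of characters of the subgroup `K(L)_n` of `n`-torsion elements of `K(L)`;
moreover every such irreducible representation has dimension
`(d₁⋯d_g)/((n,d₁)⋯(n,d_g))`, where `(n,d_k) = gcd(n,d_k)`.

The theta group is modelled abstractly as a central extension
`1 → ℂ* → 𝒢(L) → K(L) → 0` with `K(L) ≅ (ℤ/d₁ × ⋯ × ℤ/d_g)²` and
nondegenerate commutator (Weil) form. -/

/-- Abstract model of the theta group `𝒢(L)` of an ample line bundle on an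
abelian variety: a central extension `1 → ℂ* → 𝒢(L) → K(L) → 0` whose
commutator form is the Weil form `e^L`. -/
structure ThetaGroupSetup where
  /-- the points of the abelian variety `A` -/
  A : Type
  [grpA : AddCommGroup A]
  /-- the fixed group `K(L)` -/
  K : AddSubgroup A
  /-- the theta group `𝒢(L)` -/
  G : Type
  [grpG : Group G]
  /-- the central embedding `ℂ* → 𝒢(L)` -/
  iota : ℂˣ →* G
  iota_injective : Function.Injective iota
  iota_central : ∀ (c : ℂˣ) (x : G), iota c * x = x * iota c
  /-- the projection `𝒢(L) → K(L)` -/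
  proj : G → A
  proj_one : proj 1 = 0
  proj_mul : ∀ x y, proj (x * y) = proj x + proj y
  proj_mem : ∀ x, proj x ∈ K
  proj_surjOn : ∀ a ∈ K, ∃ x, proj x = a
  proj_ker : ∀ x, proj x = 0 ↔ ∃ c, x = iota c
  /-- the Weil form `e^L`, as the commutator form of `𝒢(L)` -/
  weil : A → A → ℂˣ
  weil_comm : ∀ x y : G, x * y = iota (weil (proj x) (proj y)) * (y * x)

attribute [instance] ThetaGroupSetup.grpA ThetaGroupSetup.grpG

/-- The subgroup `K(L)_n` of `n`-torsion elements of `K(L)`. -/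
def ThetaGroupSetup.nTorsion (T : ThetaGroupSetup) (n : ℕ) : AddSubgroup T.A where
  carrier := {a | a ∈ T.K ∧ n • a = 0}
  add_mem' := by
    rintro a b ⟨haK, ha⟩ ⟨hbK, hb⟩
    exact ⟨T.K.add_mem haK hbK, by rw [smul_add, ha, hb, add_zero]⟩
  zero_mem' := ⟨T.K.zero_mem, smul_zero n⟩
  neg_mem' := by
    rintro a ⟨haK, ha⟩
    exact ⟨T.K.neg_mem haK, by rw [smul_neg, ha, neg_zero]⟩

/-- A finite-dimensional irreducible representation of the theta group `𝒢(L)`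
of weight `n`: the central `ℂ*` acts by `α ↦ αⁿ`. -/
structure WeightRep (T : ThetaGroupSetup) (n : ℕ) where
  /-- the underlying vector space -/
  V : Type
  [grpV : AddCommGroup V]
  [modV : Module ℂ V]
  [fdV : FiniteDimensional ℂ V]
  [nontrivV : Nontrivial V]
  /-- the action of `𝒢(L)` -/
  ρ : T.G →* (V ≃ₗ[ℂ] V)
  /-- the representation has weight `n` -/
  weight : ∀ (c : ℂˣ) (v : V), ρ (T.iota c) v = ((c : ℂ) ^ n) • v
  /-- irreducibility -/
  irreducible : ∀ W : Submodule ℂ V, (∀ (z : T.G), ∀ v ∈ W, ρ z v ∈ W) → W = ⊥ ∨ W = ⊤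

attribute [instance] WeightRep.grpV WeightRep.modV WeightRep.fdV WeightRep.nontrivV

/-- Isomorphism of representations of `𝒢(L)`. -/
def WeightRep.Iso {T : ThetaGroupSetup} {n : ℕ} (R S : WeightRep T n) : Prop :=
  ∃ e : R.V ≃ₗ[ℂ] S.V, ∀ (z : T.G) (v : R.V), e (R.ρ z v) = S.ρ z (e v)

namespace ThetaAux

open Module

variable {T : ThetaGroupSetup} {n : ℕ}

lemma weil_add (a b c : T.A) (ha : a ∈ T.K) (hb : b ∈ T.K) (hc : c ∈ T.K) :
    T.weil (a + b) c = T.weil a c * T.weil b c := by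
  obtain ⟨x, rfl⟩ := T.proj_surjOn a ha
  obtain ⟨y, rfl⟩ := T.proj_surjOn b hb
  obtain ⟨z, rfl⟩ := T.proj_surjOn c hc
  apply T.iota_injective
  have h1 := T.weil_comm (x * y) z
  have h2 := T.weil_comm x z
  have h3 := T.weil_comm y z
  rw [T.proj_mul] at h1
  have : x * y * z = T.iota (T.weil (T.proj x) (T.proj z) * T.weil (T.proj y) (T.proj z))
      * (z * (x * y)) := by
    rw [mul_assoc, h3, ← mul_assoc, ← T.iota_central, mul_assoc, ← mul_assoc x, h2,
      mul_comm (T.weil (T.proj x) _), map_mul]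
    simp only [mul_assoc]
  rw [this] at h1
  exact (mul_right_cancel h1).symm

lemma weil_zero (c : T.A) (hc : c ∈ T.K) : T.weil 0 c = 1 := by
  have := weil_add (0 : T.A) 0 c T.K.zero_mem T.K.zero_mem hc
  simpa using this

lemma weil_nsmul (m : ℕ) (a c : T.A) (ha : a ∈ T.K) (hc : c ∈ T.K) :
    T.weil (m • a) c = T.weil a c ^ m := by
  induction m with
  | zero => simp [weil_zero c hc]
  | succ k ih => rw [succ_nsmul, weil_add _ _ _ (T.K.nsmul_mem ha k) ha hc, ih, pow_succ]

lemma proj_inv (x : T.G) : T.proj x⁻¹ = - T.proj x := by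
  rw [eq_neg_iff_add_eq_zero, ← T.proj_mul, inv_mul_cancel, T.proj_one]

lemma exists_iota_of_proj_eq {x y : T.G} (h : T.proj x = T.proj y) : ∃ c, x = T.iota c * y := by
  have : T.proj (x * y⁻¹) = 0 := by rw [T.proj_mul, proj_inv, h, add_neg_cancel]
  obtain ⟨c, hc⟩ := (T.proj_ker _).1 this
  exact ⟨c, by rw [← hc]; simp⟩

/-- homomorphism into automorphisms from one into endomorphisms -/
noncomputable def mkRho {V : Type} [AddCommGroup V] [Module ℂ V] (σ : T.G →* End ℂ V) :
    T.G →* (V ≃ₗ[ℂ] V) :=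
  (LinearMap.GeneralLinearGroup.generalLinearEquiv ℂ V).toMonoidHom.comp σ.toHomUnits

lemma mkRho_apply {V : Type} [AddCommGroup V] [Module ℂ V] (σ : T.G →* End ℂ V) (z : T.G) (v : V) :
    mkRho σ z v = σ z v := rfl

/-- endomorphism form of the action -/
noncomputable def lin (R : WeightRep T n) : T.G →* End ℂ R.V where
  toFun z := (R.ρ z).toLinearMap
  map_one' := by ext; simp
  map_mul' x y := by ext; simp

lemma lin_apply (R : WeightRep T n) (z : T.G) (v : R.V) : lin R z v = R.ρ z v := rfl

lemma lin_iota (R : WeightRep T n) (c : ℂˣ) : lin R (T.iota c) = ((c : ℂ) ^ n) • 1 := by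
  ext v; simp [lin_apply, R.weight]

lemma rho_mul (R : WeightRep T n) (x y : T.G) (v : R.V) : R.ρ (x * y) v = R.ρ x (R.ρ y v) := by
  simp

lemma rho_inv_rho (R : WeightRep T n) (x : T.G) (v : R.V) : R.ρ x⁻¹ (R.ρ x v) = v := by
  rw [← rho_mul]; simp

lemma rho_rho_inv (R : WeightRep T n) (x : T.G) (v : R.V) : R.ρ x (R.ρ x⁻¹ v) = v := by
  rw [← rho_mul]; simp

lemma schur (R : WeightRep T n) (f : End ℂ R.V) (hf : ∀ z v, f (R.ρ z v) = R.ρ z (f v)) :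
    ∃ c : ℂ, ∀ v, f v = c • v := by
  obtain ⟨c, hc⟩ := Module.End.exists_eigenvalue f
  refine ⟨c, ?_⟩
  have h := R.irreducible (f.eigenspace c) (by
    intro z v hv
    rw [Module.End.mem_eigenspace_iff] at hv ⊢
    rw [hf, hv, map_smul])
  have h2 := h.resolve_left hc
  intro v
  have : v ∈ f.eigenspace c := by rw [h2]; trivial
  exact Module.End.mem_eigenspace_iff.1 this

lemma iso_of_ne_zero (R S : WeightRep T n) (f : R.V →ₗ[ℂ] S.V)
    (hf : ∀ z v, f (R.ρ z v) = S.ρ z (f v)) (h0 : f ≠ 0) : R.Iso S := by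
  have hk : LinearMap.ker f = ⊥ := by
    refine (R.irreducible (LinearMap.ker f) ?_).resolve_right ?_
    · intro z v hv
      rw [LinearMap.mem_ker] at hv ⊢
      rw [hf, hv, map_zero]
    · intro h; exact h0 (LinearMap.ker_eq_top.1 h)
  have hr : LinearMap.range f = ⊤ := by
    refine (S.irreducible (LinearMap.range f) ?_).resolve_left ?_
    · rintro z _ ⟨v, rfl⟩
      exact ⟨R.ρ z v, hf z v⟩
    · intro h; exact h0 (LinearMap.range_eq_bot.1 h)
  exact ⟨LinearEquiv.ofBijective f ⟨LinearMap.ker_eq_bot.1 hk, LinearMap.range_eq_top.1 hr⟩,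
    fun z v => hf z v⟩

lemma rho_comm (R : WeightRep T n) (x y : T.G) (v : R.V) :
    R.ρ x (R.ρ y v) = ((T.weil (T.proj x) (T.proj y) : ℂˣ) : ℂ) ^ n • R.ρ y (R.ρ x v) := by
  rw [← rho_mul, T.weil_comm, rho_mul, R.weight, rho_mul]

lemma exists_scalar (R : WeightRep T n) (x : T.G) (hx : n • T.proj x = 0) :
    ∃ c : ℂˣ, ∀ v, R.ρ x v = (c : ℂ) • v := by
  obtain ⟨c, hc⟩ := schur R (lin R x) (by
    intro z v
    have h1 : T.weil (T.proj x) (T.proj z) ^ n = 1 := by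
      rw [← weil_nsmul _ _ _ (T.proj_mem _) (T.proj_mem _), hx, weil_zero _ (T.proj_mem _)]
    have h2 : ((T.weil (T.proj x) (T.proj z) : ℂˣ) : ℂ) ^ n = 1 := by
      rw [← Units.val_pow_eq_pow_val, h1, Units.val_one]
    rw [lin_apply, lin_apply, rho_comm, h2, one_smul])
  have h0 : c ≠ 0 := by
    rintro rfl
    obtain ⟨v, hv⟩ := exists_ne (0 : R.V)
    have := hc v
    rw [lin_apply, zero_smul] at this
    exact hv ((R.ρ x).map_eq_zero_iff.1 this)
  exact ⟨Units.mk0 c h0, hc⟩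

lemma scalar_unique (R : WeightRep T n) {c c' : ℂˣ} (h : ∀ v : R.V, (c : ℂ) • v = (c' : ℂ) • v) :
    c = c' := by
  obtain ⟨v, hv⟩ := exists_ne (0 : R.V)
  exact Units.ext (smul_left_injective ℂ hv (h v))

open Classical in
/-- central character, extended by one -/
noncomputable def cch (R : WeightRep T n) (x : T.G) : ℂˣ :=
  if hx : n • T.proj x = 0 then (exists_scalar R x hx).choose else 1

lemma cch_spec (R : WeightRep T n) (x : T.G) (hx : n • T.proj x = 0) (v : R.V) :
    R.ρ x v = (cch R x : ℂ) • v := by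
  rw [cch, dif_pos hx]
  exact (exists_scalar R x hx).choose_spec v

lemma cch_mul (R : WeightRep T n) (x y : T.G) (hx : n • T.proj x = 0) (hy : n • T.proj y = 0) :
    cch R (x * y) = cch R x * cch R y := by
  apply scalar_unique R
  intro v
  rw [← cch_spec R _ (by rw [T.proj_mul, smul_add, hx, hy, add_zero]), rho_mul, cch_spec R y hy,
    cch_spec R x hx, smul_smul, Units.val_mul]

lemma cch_iota (R : WeightRep T n) (c : ℂˣ) : cch R (T.iota c) = c ^ n := by
  apply scalar_unique R
  intro v
  rw [← cch_spec R _ (by rw [(T.proj_ker _).2 ⟨c, rfl⟩, smul_zero]), R.weight]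
  simp

lemma cch_iso (R S : WeightRep T n) (h : R.Iso S) (x : T.G) (hx : n • T.proj x = 0) :
    cch R x = cch S x := by
  obtain ⟨e, he⟩ := h
  apply scalar_unique S
  intro v
  have := he x (e.symm v)
  rw [cch_spec R x hx, map_smul, cch_spec S x hx, e.apply_symm_apply] at this
  exact this

lemma trace_scalar (R : WeightRep T n) (x : T.G) (hx : n • T.proj x = 0) :
    LinearMap.trace ℂ R.V (lin R x) = cch R x * finrank ℂ R.V := by
  have : lin R x = (cch R x : ℂ) • 1 := by
    ext v; simp [lin_apply, cch_spec R x hx]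
  rw [this, map_smul, LinearMap.trace_one, smul_eq_mul]

lemma trace_zero (hnondeg : ∀ a ∈ T.K, (∀ b ∈ T.K, T.weil a b = 1) → a = 0)
    (R : WeightRep T n) (x : T.G) (hx : n • T.proj x ≠ 0) :
    LinearMap.trace ℂ R.V (lin R x) = 0 := by
  have : ∃ y, T.weil (T.proj x) (T.proj y) ^ n ≠ 1 := by
    by_contra! h
    apply hx
    apply hnondeg _ (T.K.nsmul_mem (T.proj_mem x) n)
    intro b hb
    obtain ⟨y, rfl⟩ := T.proj_surjOn b hb
    rw [weil_nsmul _ _ _ (T.proj_mem x) hb, h]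
  obtain ⟨y, hy⟩ := this
  set w := T.weil (T.proj x) (T.proj y) with hw
  have h1 : lin R x * lin R y = ((w : ℂ) ^ n) • (lin R y * lin R x) := by
    ext v
    simp only [Module.End.mul_apply, LinearMap.smul_apply, lin_apply]
    exact rho_comm R x y v
  have h2 : lin R x = ((w : ℂ) ^ n) • (lin R y * lin R x * lin R y⁻¹) := by
    rw [← smul_mul_assoc, ← h1, mul_assoc, ← map_mul, mul_inv_cancel, map_one, mul_one]
  have h3 : LinearMap.trace ℂ R.V (lin R y * lin R x * lin R y⁻¹)
      = LinearMap.trace ℂ R.V (lin R x) := by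
    rw [LinearMap.trace_mul_comm, ← mul_assoc, ← map_mul, inv_mul_cancel, map_one, one_mul]
  have h4 := congrArg (LinearMap.trace ℂ R.V) h2
  rw [map_smul, h3, smul_eq_mul] at h4
  have h5 : (w : ℂ) ^ n ≠ 1 := by
    intro h; apply hy; apply Units.ext; simpa using h
  by_contra h6
  exact h5 (mul_right_cancel₀ h6 (by rw [one_mul]; exact h4.symm))

/-- a section of the projection -/
noncomputable def sec (k : T.K) : T.G := (T.proj_surjOn k.1 k.2).choose

lemma proj_sec (k : T.K) : T.proj (sec k) = k := (T.proj_surjOn k.1 k.2).choose_spec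

/-- conjugation of a linear map -/
noncomputable def cj (R S : WeightRep T n) (t : R.V →ₗ[ℂ] S.V) (x : T.G) : R.V →ₗ[ℂ] S.V :=
  lin S x ∘ₗ t ∘ₗ lin R x⁻¹

lemma cj_apply (R S : WeightRep T n) (t : R.V →ₗ[ℂ] S.V) (x : T.G) (v : R.V) :
    cj R S t x v = S.ρ x (t (R.ρ x⁻¹ v)) := rfl

lemma cj_eq (R S : WeightRep T n) (t : R.V →ₗ[ℂ] S.V) {x y : T.G} (h : T.proj x = T.proj y) :
    cj R S t x = cj R S t y := by
  obtain ⟨c, rfl⟩ := exists_iota_of_proj_eq h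
  ext v
  rw [cj_apply, cj_apply, mul_inv_rev, rho_mul, rho_mul, ← map_inv, R.weight, map_smul, map_smul,
    map_smul, map_smul, S.weight, smul_smul, Units.val_inv_eq_inv_val, ← mul_pow,
    inv_mul_cancel₀ c.ne_zero, one_pow, one_smul]

lemma cj_mul (R S : WeightRep T n) (t : R.V →ₗ[ℂ] S.V) (x y : T.G) (v : R.V) :
    cj R S t (y * x) (R.ρ y v) = S.ρ y (cj R S t x v) := by
  rw [cj_apply, cj_apply, mul_inv_rev, rho_mul, rho_mul, rho_inv_rho]

/-- averaging -/
noncomputable def avg [Fintype T.K] (R S : WeightRep T n) (t : R.V →ₗ[ℂ] S.V) : R.V →ₗ[ℂ] S.V :=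
  ∑ k : T.K, cj R S t (sec k)

lemma avg_comm [Fintype T.K] (R S : WeightRep T n) (t : R.V →ₗ[ℂ] S.V) (z : T.G) (v : R.V) :
    avg R S t (R.ρ z v) = S.ρ z (avg R S t v) := by
  simp only [avg, LinearMap.sum_apply, map_sum]
  let a : T.K := ⟨T.proj z, T.proj_mem z⟩
  rw [← Equiv.sum_comp (Equiv.addLeft a)]
  refine Finset.sum_congr rfl fun k _ => ?_
  rw [← cj_mul]
  congr 1
  apply cj_eq
  rw [proj_sec, T.proj_mul, proj_sec]; rfl

open Classical in
lemma avg_key [Fintype T.K] (hnondeg : ∀ a ∈ T.K, (∀ b ∈ T.K, T.weil a b = 1) → a = 0)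
    (R S : WeightRep T n) (hRS : ∀ x, n • T.proj x = 0 → cch R x = cch S x) (w : S.V) :
    ∑ i, avg R S (((finBasis ℂ R.V).coord i).smulRight w) (finBasis ℂ R.V i) =
      ((Fintype.card {k : T.K // n • (k : T.A) = 0} : ℂ) * finrank ℂ R.V) • w := by
  simp only [avg, LinearMap.sum_apply, cj_apply, LinearMap.smulRight_apply, map_smul]
  rw [Finset.sum_comm]
  have h1 : ∀ k : T.K, ∑ i, ((finBasis ℂ R.V).coord i (R.ρ (sec k)⁻¹ (finBasis ℂ R.V i))) •
      S.ρ (sec k) w = if n • (k : T.A) = 0 then (finrank ℂ R.V : ℂ) • w else 0 := by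
    intro k
    have ht : ∑ i, ((finBasis ℂ R.V).coord i (R.ρ (sec k)⁻¹ (finBasis ℂ R.V i))) =
        LinearMap.trace ℂ R.V (lin R (sec k)⁻¹) := by
      rw [LinearMap.trace_eq_matrix_trace ℂ (finBasis ℂ R.V)]
      simp [Matrix.trace, LinearMap.toMatrix_apply, lin_apply]
    rw [← Finset.sum_smul, ht]
    have hp : T.proj (sec k)⁻¹ = - (k : T.A) := by rw [proj_inv, proj_sec]
    split_ifs with hk
    · have hk' : n • T.proj (sec k)⁻¹ = 0 := by rw [hp, smul_neg, hk, neg_zero]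
      have hk2 : n • T.proj (sec k) = 0 := by rw [proj_sec, hk]
      rw [trace_scalar _ _ hk', cch_spec S _ hk2, smul_smul]
      congr 1
      have : cch R (sec k)⁻¹ * cch S (sec k) = 1 := by
        rw [hRS _ hk', ← cch_mul _ _ _ hk' hk2, inv_mul_cancel, ← map_one T.iota, cch_iota,
          one_pow]
      have h' : (cch R (sec k)⁻¹ : ℂ) * (cch S (sec k) : ℂ) = 1 := by
        rw [← Units.val_mul, this, Units.val_one]
      linear_combination (finrank ℂ R.V : ℂ) * h'
    · rw [trace_zero hnondeg, zero_smul]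
      rw [hp, smul_neg, neg_ne_zero]; exact hk
  rw [Finset.sum_congr rfl fun k _ => h1 k, ← Finset.sum_filter, Finset.sum_const,
    Fintype.card_subtype, ← Nat.cast_smul_eq_nsmul ℂ, smul_smul]

open Classical in
lemma cardpos [Fintype T.K] : 0 < Fintype.card {k : T.K // n • (k : T.A) = 0} :=
  Fintype.card_pos_iff.2 ⟨⟨0, by simp⟩⟩

open Classical in
lemma iso_of_cch [Fintype T.K] (hnondeg : ∀ a ∈ T.K, (∀ b ∈ T.K, T.weil a b = 1) → a = 0)
    (R S : WeightRep T n) (hRS : ∀ x, n • T.proj x = 0 → cch R x = cch S x) : R.Iso S := by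
  obtain ⟨w, hw⟩ := exists_ne (0 : S.V)
  by_contra hcon
  have hz : ∀ t, avg R S t = 0 := fun t => by
    by_contra h
    exact hcon (iso_of_ne_zero R S _ (avg_comm R S t) h)
  have := avg_key hnondeg R S hRS w
  simp only [hz, LinearMap.zero_apply, Finset.sum_const_zero] at this
  have h2 : ((Fintype.card {k : T.K // n • (k : T.A) = 0} : ℂ) * finrank ℂ R.V) ≠ 0 :=
    mul_ne_zero (Nat.cast_ne_zero.2 cardpos.ne') (Nat.cast_ne_zero.2 finrank_pos.ne')
  exact (smul_ne_zero h2 hw) this.symm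

open Classical in
lemma dim_sq [Fintype T.K] (hnondeg : ∀ a ∈ T.K, (∀ b ∈ T.K, T.weil a b = 1) → a = 0)
    (R : WeightRep T n) :
    Fintype.card {k : T.K // n • (k : T.A) = 0} * finrank ℂ R.V ^ 2 = Fintype.card T.K := by
  obtain ⟨w, hw⟩ := exists_ne (0 : R.V)
  have hd : (finrank ℂ R.V : ℂ) ≠ 0 := Nat.cast_ne_zero.2 finrank_pos.ne'
  have h1 : ∀ (t : End ℂ R.V) v, (finrank ℂ R.V : ℂ) • avg R R t v =
      ((Fintype.card T.K : ℂ) * LinearMap.trace ℂ R.V t) • v := by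
    intro t v
    obtain ⟨c, hc⟩ := schur R (avg R R t) (avg_comm R R t)
    have h2 : avg R R t = c • (1 : End ℂ R.V) := by ext v; simp [hc]
    have h3 : LinearMap.trace ℂ R.V (avg R R t) = Fintype.card T.K * LinearMap.trace ℂ R.V t := by
      rw [avg, map_sum]
      have : ∀ x, LinearMap.trace ℂ R.V (cj R R t x) = LinearMap.trace ℂ R.V t := by
        intro x
        change LinearMap.trace ℂ R.V (lin R x * (t * lin R x⁻¹)) = _
        rw [LinearMap.trace_mul_comm, mul_assoc, ← map_mul, inv_mul_cancel, map_one, mul_one]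
      simp [this]
    rw [← h3, h2]
    simp [smul_smul, mul_comm]
  have key := avg_key hnondeg R R (fun _ _ => rfl) w
  have h4 := congrArg ((finrank ℂ R.V : ℂ) • ·) key
  simp only [Finset.smul_sum, h1, smul_smul] at h4
  have h5 : ∀ i, LinearMap.trace ℂ R.V (((finBasis ℂ R.V).coord i).smulRight w) =
      (finBasis ℂ R.V).coord i w := fun i => by
    rw [LinearMap.trace_smulRight]
  simp only [h5, ← smul_smul, ← Finset.smul_sum] at h4
  have h6 : ∑ i, (finBasis ℂ R.V).coord i w • finBasis ℂ R.V i = w :=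
    (finBasis ℂ R.V).sum_repr w
  rw [h6] at h4
  simp only [smul_smul] at h4
  have h7 := smul_left_injective ℂ hw h4
  have h8 : ((Fintype.card {k : T.K // n • (k : T.A) = 0} * finrank ℂ R.V ^ 2 : ℕ) : ℂ)
      = (Fintype.card T.K : ℕ) := by
    push_cast
    linear_combination -h7
  exact_mod_cast h8

lemma exists_rep_of_end {V : Type} [AddCommGroup V] [Module ℂ V] [FiniteDimensional ℂ V]
    [Nontrivial V] (σ : T.G →* End ℂ V) (hσ : ∀ c v, σ (T.iota c) v = ((c : ℂ) ^ n) • v) :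
    Nonempty (WeightRep T n) := by
  let P : Set (Submodule ℂ V) := {W | W ≠ ⊥ ∧ ∀ z, ∀ v ∈ W, σ z v ∈ W}
  have hP : P.Nonempty := ⟨⊤, top_ne_bot, fun _ _ _ => trivial⟩
  obtain ⟨W, hW, hmin⟩ := WellFounded.has_min (wellFounded_lt (α := Submodule ℂ V)) P hP
  let τ : T.G →* End ℂ W :=
    { toFun := fun z => (σ z).restrict (hW.2 z)
      map_one' := by ext v; simp
      map_mul' := fun x y => by ext v; simp }
  have : Nontrivial W := (Submodule.nontrivial_iff_ne_bot).2 hW.1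
  refine ⟨{ V := W, ρ := mkRho τ, weight := ?_, irreducible := ?_ }⟩
  · intro c v
    rw [mkRho_apply]
    ext
    exact hσ c v
  · intro U hU
    by_contra! h
    have hlt : U.map W.subtype < W := by
      refine lt_of_le_of_ne (Submodule.map_subtype_le W U) ?_
      intro he
      apply h.2
      rw [eq_top_iff]
      rintro ⟨x, hx⟩ -
      rw [← he] at hx
      obtain ⟨y, hy, hyx⟩ := hx
      have : y = ⟨x, by rw [← hyx]; exact y.2⟩ := Subtype.ext hyx
      rw [← this]; exact hy
    refine hmin (U.map W.subtype) ⟨?_, ?_⟩ hlt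
    · intro h0
      apply h.1
      rw [eq_bot_iff]
      intro u hu
      have hm : W.subtype u ∈ U.map W.subtype := ⟨u, hu, rfl⟩
      rw [h0, Submodule.mem_bot] at hm
      exact (Submodule.mem_bot ℂ).2 (Subtype.ext hm)
    · rintro z _ ⟨u, hu, rfl⟩
      exact ⟨mkRho τ z u, hU z u hu, rfl⟩

/-- functions of weight `n` on the theta group -/
def funs (T : ThetaGroupSetup) (n : ℕ) : Submodule ℂ (T.G → ℂ) where
  carrier := {f | ∀ c x, f (T.iota c * x) = ((c : ℂ) ^ n) * f x}
  add_mem' := by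
    intro f g hf hg c x
    simp [hf c x, hg c x, mul_add]
  zero_mem' := by intro c x; simp
  smul_mem' := by
    intro a f hf c x
    simp [hf c x]; ring

/-- right translation -/
def trans (T : ThetaGroupSetup) (n : ℕ) : T.G →* End ℂ (funs T n) where
  toFun z :=
    { toFun := fun f => ⟨fun x => f.1 (x * z), fun c x => by
        change f.1 (T.iota c * x * z) = _
        rw [mul_assoc]; exact f.2 c (x * z)⟩
      map_add' := fun f g => rfl
      map_smul' := fun a f => rfl }
  map_one' := by ext f x; simp
  map_mul' := fun y z => by
    ext f x
    simp [mul_assoc]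

lemma exists_rep [Finite T.K] : Nonempty (WeightRep T n) := by
  classical
  let r : funs T n →ₗ[ℂ] (T.K → ℂ) :=
    { toFun := fun f k => f.1 (sec k)
      map_add' := fun f g => rfl
      map_smul' := fun a f => rfl }
  have hr : Function.Injective r := by
    rw [← LinearMap.ker_eq_bot, LinearMap.ker_eq_bot']
    intro f hf
    ext x
    have hx : T.proj x = T.proj (sec (⟨T.proj x, T.proj_mem x⟩ : T.K)) := by rw [proj_sec]
    obtain ⟨c, hc⟩ := exists_iota_of_proj_eq hx
    rw [hc, f.2 c]
    have : f.1 (sec (⟨T.proj x, T.proj_mem x⟩ : T.K)) = 0 := congrFun hf _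
    rw [this]; simp
  have : FiniteDimensional ℂ (funs T n) := FiniteDimensional.of_injective r hr
  have : Nontrivial (funs T n) := by
    let f0 : T.G → ℂ := fun x => if h : ∃ c, x = T.iota c then ((h.choose : ℂˣ) : ℂ) ^ n else 0
    have h0 : ∀ c, f0 (T.iota c) = (c : ℂ) ^ n := by
      intro c
      have h : ∃ c', T.iota c = T.iota c' := ⟨c, rfl⟩
      have e := T.iota_injective h.choose_spec
      simp only [f0]
      rw [dif_pos h, ← e]
    have h1 : f0 ∈ funs T n := by
      intro c x
      by_cases h : ∃ c', x = T.iota c'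
      · obtain ⟨c', rfl⟩ := h
        rw [← map_mul, h0, h0]; simp [mul_pow]
      · have h' : ¬ ∃ c', T.iota c * x = T.iota c' := by
          rintro ⟨c', hc'⟩
          exact h ⟨c⁻¹ * c', by rw [map_mul, ← hc', map_inv]; simp⟩
        simp only [f0]
        rw [dif_neg h, dif_neg h', mul_zero]
    refine ⟨⟨f0, h1⟩, 0, fun h => ?_⟩
    have h2 : f0 (T.iota 1) = 0 := by
      have := congrArg (fun f : funs T n => f.1 (T.iota 1)) h
      exact this
    rw [h0] at h2
    simp at h2
  refine exists_rep_of_end (trans T n) ?_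
  intro c f
  ext x
  change f.1 (x * T.iota c) = _
  rw [← T.iota_central, f.2 c]; rfl

/-- twisting by a character of `K` -/
noncomputable def twist (R : WeightRep T n) (φ : AddChar T.K ℂˣ) : WeightRep T n where
  V := R.V
  ρ := mkRho (T := T)
    { toFun := fun z => (φ ⟨T.proj z, T.proj_mem z⟩ : ℂ) • lin R z
      map_one' := by
        have : (⟨T.proj 1, T.proj_mem 1⟩ : T.K) = 0 := Subtype.ext T.proj_one
        rw [this]; simp
      map_mul' := fun x y => by
        have : (⟨T.proj (x * y), T.proj_mem _⟩ : T.K) = ⟨T.proj x, T.proj_mem x⟩ +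
          ⟨T.proj y, T.proj_mem y⟩ := Subtype.ext (T.proj_mul x y)
        rw [this, AddChar.map_add_eq_mul, map_mul, Units.val_mul, smul_mul_smul_comm] }
  weight c v := by
    have : (⟨T.proj (T.iota c), T.proj_mem _⟩ : T.K) = 0 :=
      Subtype.ext ((T.proj_ker _).2 ⟨c, rfl⟩)
    rw [mkRho_apply]
    simp [this, lin_apply, R.weight]
  irreducible W hW := by
    apply R.irreducible W
    intro z v hv
    have h := W.smul_mem ((φ ⟨T.proj z, T.proj_mem z⟩)⁻¹ : ℂˣ) (hW z v hv)
    rw [mkRho_apply] at h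
    simpa [smul_smul, lin_apply] using h

lemma twist_apply (R : WeightRep T n) (φ : AddChar T.K ℂˣ) (z : T.G) (v : R.V) :
    (twist R φ).ρ z v = (φ ⟨T.proj z, T.proj_mem z⟩ : ℂ) • R.ρ z v := rfl

lemma cch_twist (R : WeightRep T n) (φ : AddChar T.K ℂˣ) (x : T.G) (hx : n • T.proj x = 0) :
    cch (twist R φ) x = φ ⟨T.proj x, T.proj_mem x⟩ * cch R x := by
  apply scalar_unique (twist R φ)
  intro v
  rw [← cch_spec _ x hx]
  have h : ∀ v : R.V, (φ ⟨T.proj x, T.proj_mem x⟩ : ℂ) • R.ρ x v =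
      ((φ ⟨T.proj x, T.proj_mem x⟩ * cch R x : ℂˣ) : ℂ) • v := fun v => by
    rw [cch_spec R x hx, Units.val_mul, smul_smul]
  exact h v

/-- ratio of central characters -/
noncomputable def rat (R₀ R : WeightRep T n) (x : T.G) : ℂˣ := cch R x / cch R₀ x

lemma rat_mul (R₀ R : WeightRep T n) (x y : T.G) (hx : n • T.proj x = 0) (hy : n • T.proj y = 0) :
    rat R₀ R (x * y) = rat R₀ R x * rat R₀ R y := by
  rw [rat, rat, rat, cch_mul _ _ _ hx hy, cch_mul _ _ _ hx hy, mul_div_mul_comm]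

lemma rat_iota (R₀ R : WeightRep T n) (c : ℂˣ) : rat R₀ R (T.iota c) = 1 := by
  rw [rat, cch_iota, cch_iota, div_self']

lemma rat_eq (R₀ R : WeightRep T n) {x y : T.G} (h : T.proj x = T.proj y) (hx : n • T.proj x = 0) :
    rat R₀ R x = rat R₀ R y := by
  have hy : n • T.proj y = 0 := h ▸ hx
  obtain ⟨c, rfl⟩ := exists_iota_of_proj_eq h
  rw [rat_mul _ _ _ _ (by rw [(T.proj_ker _).2 ⟨c, rfl⟩, smul_zero]) hy, rat_iota, one_mul]

/-- character attached to a representation -/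
noncomputable def chr (R₀ R : WeightRep T n) : AddChar (T.nTorsion n) ℂˣ where
  toFun a := rat R₀ R (sec ⟨a.1, a.2.1⟩)
  map_zero_eq_one' := by
    rw [rat_eq R₀ R (y := T.iota 1), rat_iota]
    · rw [proj_sec, (T.proj_ker _).2 ⟨1, rfl⟩]; rfl
    · rw [proj_sec]; exact smul_zero n
  map_add_eq_mul' a b := by
    rw [← rat_mul]
    · apply rat_eq
      · rw [proj_sec, T.proj_mul, proj_sec, proj_sec]; rfl
      · rw [proj_sec]; exact (a + b).2.2
    · rw [proj_sec]; exact a.2.2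
    · rw [proj_sec]; exact b.2.2

lemma chr_apply (R₀ R : WeightRep T n) (x : T.G) (hx : n • T.proj x = 0) :
    chr R₀ R ⟨T.proj x, T.proj_mem x, hx⟩ = rat R₀ R x := by
  change rat R₀ R (sec _) = _
  apply rat_eq
  · rw [proj_sec]
  · rw [proj_sec]; exact hx

lemma chr_apply' (R₀ R : WeightRep T n) (a : T.nTorsion n) :
    chr R₀ R a = rat R₀ R (sec ⟨a.1, a.2.1⟩) := rfl

lemma extend [Finite T.K] (ψ : AddChar (T.nTorsion n) ℂˣ) :
    ∃ φ : AddChar T.K ℂˣ, ∀ a : T.nTorsion n, φ ⟨a.1, a.2.1⟩ = ψ a := by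
  let H : Subgroup (Multiplicative T.K) :=
    AddSubgroup.toSubgroup ((T.nTorsion n).addSubgroupOf T.K)
  let θ : H →* ℂˣ :=
    { toFun := fun a => ψ ⟨(a.1.toAdd : T.K).1, a.2⟩
      map_one' := ψ.map_zero_eq_one
      map_mul' := fun a b => ψ.map_add_eq_mul ⟨(a.1.toAdd : T.K).1, a.2⟩
        ⟨(b.1.toAdd : T.K).1, b.2⟩ }
  have : NeZero (Monoid.exponent (Multiplicative T.K)) :=
    ⟨Monoid.exponent_ne_zero_of_finite⟩
  have : NeZero ((Monoid.exponent (Multiplicative T.K) : ℕ) : ℂ) := inferInstance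
  obtain ⟨Θ, hΘ⟩ := MonoidHom.domRestrict_surjective (M := ℂ) H θ
  refine ⟨AddChar.toMonoidHomEquiv.symm Θ, fun a => ?_⟩
  have := DFunLike.congr_fun hΘ ⟨Multiplicative.ofAdd (⟨a.1, a.2.1⟩ : T.K), a.2⟩
  exact this

lemma card_tors_zmod (m d : ℕ) (hd : 0 < d) :
    Nat.card {a : ZMod d // m • a = 0} = Nat.gcd m d := by
  have : NeZero d := ⟨hd.ne'⟩
  have := IsAddCyclic.card_nsmulAddMonoidHom_ker (G := ZMod d) m
  rw [Nat.card_zmod, Nat.gcd_comm] at this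
  rw [← this]
  rfl

lemma card_tors_pi {g : ℕ} (d : Fin g → ℕ) (hd : ∀ i, 0 < d i) (m : ℕ) :
    Nat.card {a : ∀ i, ZMod (d i) // m • a = 0} = ∏ i, Nat.gcd m (d i) := by
  rw [← Finset.prod_congr rfl fun i _ => card_tors_zmod m (d i) (hd i), ← Nat.card_pi]
  refine Nat.card_congr ((Equiv.subtypeEquivRight fun a => ?_).trans
    (Equiv.subtypePiEquivPi (p := fun i (a : ZMod (d i)) => m • a = 0)))
  exact funext_iff

lemma card_tors_prod {g : ℕ} (d : Fin g → ℕ) (hd : ∀ i, 0 < d i) (m : ℕ) :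
    Nat.card {a : (∀ i, ZMod (d i)) × (∀ i, ZMod (d i)) // m • a = 0} =
      (∏ i, Nat.gcd m (d i)) ^ 2 := by
  rw [sq, ← card_tors_pi d hd m, ← Nat.card_prod]
  refine Nat.card_congr ((Equiv.subtypeEquivRight fun a => ?_).trans
    (Equiv.subtypeProdEquivProd))
  exact Prod.ext_iff

end ThetaAux

/-- The irreducible weight-`n` representations of the theta group `𝒢(L)` of an
ample line bundle of type `(d₁,…,d_g)` are classified, up to isomorphism, by
the characters of `K(L)_n`, and each has dimension
`(d₁⋯d_g)/((n,d₁)⋯(n,d_g))`. -/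
theorem statement14 (g : ℕ) (d : Fin g → ℕ) (hd : ∀ i, 0 < d i)
    (hdiv : ∀ i j : Fin g, i ≤ j → d i ∣ d j)
    (T : ThetaGroupSetup)
    -- `K(L) ≅ (ℤ/d₁ × ⋯ × ℤ/d_g)²`
    (hK : Nonempty (↥T.K ≃+ ((∀ i, ZMod (d i)) × (∀ i, ZMod (d i)))))
    -- the Weil form is nondegenerate on `K(L)`
    (hnondeg : ∀ a ∈ T.K, (∀ b ∈ T.K, T.weil a b = 1) → a = 0)
    (n : ℕ) (hn : 1 ≤ n) :
    -- the isomorphism classes of irreducible weight-`n` representations are in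
    -- bijection with the characters of `K(L)_n`
    Nonempty (Quot (WeightRep.Iso (T := T) (n := n)) ≃ AddChar (T.nTorsion n) ℂˣ) ∧
    -- the dimension of any such representation is `(d₁⋯d_g)/((n,d₁)⋯(n,d_g))`
    (∀ R : WeightRep T n,
      Module.finrank ℂ R.V = (∏ i, d i) / ∏ i, Nat.gcd n (d i)) := by
  classical
  obtain ⟨e⟩ := hK
  have : ∀ i, NeZero (d i) := fun i => ⟨(hd i).ne'⟩
  have : Finite T.K := Finite.of_equiv _ e.symm.toEquiv
  let _ : Fintype T.K := Fintype.ofFinite _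
  obtain ⟨R₀⟩ := ThetaAux.exists_rep (T := T) (n := n)
  refine ⟨⟨Equiv.ofBijective (Quot.lift (ThetaAux.chr R₀) ?_) ⟨?_, ?_⟩⟩, ?_⟩
  · intro R S h
    ext a
    rw [ThetaAux.chr_apply', ThetaAux.chr_apply', ThetaAux.rat, ThetaAux.rat,
      ThetaAux.cch_iso R S h]
    rw [ThetaAux.proj_sec]; exact a.2.2
  · rintro ⟨R⟩ ⟨S⟩ h
    apply Quot.sound
    apply ThetaAux.iso_of_cch hnondeg
    intro x hx
    have h' : ThetaAux.chr R₀ R = ThetaAux.chr R₀ S := h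
    have h2 := ThetaAux.chr_apply R₀ R x hx
    rw [h', ThetaAux.chr_apply _ _ _ hx] at h2
    exact (div_left_inj.1 h2).symm
  · intro ψ
    obtain ⟨φ, hφ⟩ := ThetaAux.extend ψ
    refine ⟨Quot.mk _ (ThetaAux.twist R₀ φ), ?_⟩
    change ThetaAux.chr R₀ (ThetaAux.twist R₀ φ) = ψ
    ext a
    obtain ⟨a, haK, ha⟩ := a
    obtain ⟨x, rfl⟩ := T.proj_surjOn a haK
    rw [ThetaAux.chr_apply _ _ _ ha, ThetaAux.rat, ThetaAux.cch_twist _ _ _ ha, mul_div_cancel_right,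
      ← hφ]
  · intro R
    have h1 := ThetaAux.dim_sq hnondeg R
    have h2 : Fintype.card T.K = (∏ i, d i) ^ 2 := by
      rw [← Nat.card_eq_fintype_card, Nat.card_congr e.toEquiv, Nat.card_prod, Nat.card_pi, sq]
      simp
    have h3 : Fintype.card {k : T.K // n • (k : T.A) = 0} = (∏ i, Nat.gcd n (d i)) ^ 2 := by
      rw [← ThetaAux.card_tors_prod d hd n, ← Nat.card_eq_fintype_card]
      refine Nat.card_congr (e.toEquiv.subtypeEquiv fun k => ?_)
      change _ ↔ n • e k = 0
      rw [← map_nsmul, EmbeddingLike.map_eq_zero_iff, Subtype.ext_iff]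
      rfl
    rw [h2, h3, ← mul_pow] at h1
    have h4 := Nat.pow_left_injective two_ne_zero h1
    rw [← h4, Nat.mul_div_cancel_left]
    exact Finset.prod_pos fun i _ => Nat.gcd_pos_of_pos_right _ (hd i)
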